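/- For every t ∈ [0,1), the spectrum of C_t acting on H^∞ and the spectrum of C_t acting on A(𝔻) both equal {1/(m+1) : m ∈ ℕ₀} ∪ {0}. -/

import Mathlib

open Complex MeasureTheory Metric Set Filter Topology

/-- The generalized Cesàro operator `C_t`, given by
`(C_t f)(z) = ∫_0^1 f(sz)/(1 - s t z) ds`, which equals `f(0)` at `z = 0` and
`(1/z)∫_0^z f(ξ)/(1 - tξ) dξ` for `z ≠ 0`. -/
noncomputable def cesaro (t : ℝ) (f : ℂ → ℂ) (z : ℂ) : ℂ :=
  ∫ s in (0:ℝ)..1, f ((s : ℂ) * z) / (1 - (s : ℂ) * (t : ℂ) * z)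

/-- The sup norm `‖f‖_∞ = sup_{z ∈ 𝔻} |f z|`. -/
noncomputable def supNorm (f : ℂ → ℂ) : ℝ :=
  sSup ((fun z => ‖f z‖) '' Metric.ball (0:ℂ) 1)

/-- Membership in `H^∞`: holomorphic and bounded on the open unit disc. -/
def MemHinf (f : ℂ → ℂ) : Prop :=
  DifferentiableOn ℂ f (Metric.ball (0:ℂ) 1) ∧
    BddAbove ((fun z => ‖f z‖) '' Metric.ball (0:ℂ) 1)

/-- Membership in the disc algebra `A(𝔻)`: holomorphic on the open unit disc and
continuous on the closed unit disc (i.e. extends continuously to the closed disc). -/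
def MemDiscAlg (f : ℂ → ℂ) : Prop :=
  DifferentiableOn ℂ f (Metric.ball (0:ℂ) 1) ∧ ContinuousOn f (Metric.closedBall (0:ℂ) 1)

/-- `λ` is in the resolvent set of the operator `T` acting on the space
`X = {f : Mem f}` with norm `N`: the operator `λI - T` maps `X` into `X`, is
surjective onto `X` (modulo equality on the disc) and has a continuous (linear)
inverse, i.e. it is bounded below. -/
def IsResolventPt (Mem : (ℂ → ℂ) → Prop) (N : (ℂ → ℂ) → ℝ)
    (T : (ℂ → ℂ) → ℂ → ℂ) (lam : ℂ) : Prop :=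
  (∀ f, Mem f → Mem (fun z => lam * f z - T f z)) ∧
  (∀ g, Mem g → ∃ f, Mem f ∧ Set.EqOn (fun z => lam * f z - T f z) g (Metric.ball (0:ℂ) 1)) ∧
  (∃ C : ℝ, ∀ f, Mem f → N f ≤ C * N (fun z => lam * f z - T f z))

/-- The weighted average `∫_0^1 s^N k(sz) ds`. -/
noncomputable def moment (N : ℕ) (k : ℂ → ℂ) (z : ℂ) : ℂ :=
  ∫ s in (0:ℝ)..1, (s : ℂ) ^ N * k (s * z)

/-- The operator `f ↦ z^{-N} C_t (z^N f)`, given by `∫_0^1 s^N f(sz)/(1 - stz) ds`. -/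
noncomputable def shiftedCesaro (t : ℝ) (N : ℕ) (f : ℂ → ℂ) : ℂ → ℂ :=
  moment N fun w => f w / (1 - t * w)

lemma cesaro_eq_shiftedCesaro_zero (t : ℝ) (f : ℂ → ℂ) : cesaro t f = shiftedCesaro t 0 f := by
  funext z
  simp only [cesaro, shiftedCesaro, moment, pow_zero, one_mul]
  congr 1
  funext s
  ring_nf

lemma ofReal_mul_mem_ball {s : ℝ} {z : ℂ} (h0 : 0 ≤ s) (h1 : s ≤ 1) {r : ℝ}
    (hz : z ∈ ball (0:ℂ) r) :
    (s : ℂ) * z ∈ ball (0:ℂ) r := by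
  rw [mem_ball_zero_iff] at hz ⊢
  rw [norm_mul, norm_real, Real.norm_of_nonneg h0]
  nlinarith [norm_nonneg z]

lemma ofReal_mul_mem_ball_of_lt {s : ℝ} {z : ℂ} (h0 : 0 ≤ s) (h1 : s < 1)
    (hz : z ∈ closedBall (0:ℂ) 1) : (s : ℂ) * z ∈ ball (0:ℂ) 1 := by
  rw [mem_closedBall_zero_iff] at hz
  rw [mem_ball_zero_iff, norm_mul, norm_real, Real.norm_of_nonneg h0]
  nlinarith [norm_nonneg z]

lemma continuousOn_moment_integrand {N : ℕ} {k : ℂ → ℂ} {z : ℂ}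
    (hk : ContinuousOn k (ball 0 1)) (hz : z ∈ ball (0:ℂ) 1) :
    ContinuousOn (fun s : ℝ => (s : ℂ) ^ N * k (s * z)) (Icc 0 1) := by
  refine (by fun_prop : Continuous fun s : ℝ => (s : ℂ) ^ N).continuousOn.mul ?_
  exact hk.comp (by fun_prop : Continuous fun s : ℝ => (s : ℂ) * z).continuousOn
    fun s hs => ofReal_mul_mem_ball hs.1 hs.2 hz

lemma intervalIntegrable_moment {N : ℕ} {k : ℂ → ℂ} {z : ℂ}
    (hk : ContinuousOn k (ball 0 1)) (hz : z ∈ ball (0:ℂ) 1) :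
    IntervalIntegrable (fun s : ℝ => (s : ℂ) ^ N * k (s * z)) volume 0 1 := by
  refine ContinuousOn.intervalIntegrable ?_
  rw [uIcc_of_le zero_le_one]
  exact continuousOn_moment_integrand hk hz

lemma norm_moment_le {N : ℕ} {k : ℂ → ℂ} {z : ℂ} {K : ℝ}
    (hK : ∀ w ∈ ball (0:ℂ) 1, ‖k w‖ ≤ K) (hz : z ∈ ball (0:ℂ) 1) :
    ‖moment N k z‖ ≤ K / (N + 1) := by
  have h : ∫ s in (0:ℝ)..1, s ^ N * K = K / (N + 1) := by
    rw [intervalIntegral.integral_mul_const, integral_pow]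
    simp
    ring
  rw [← h]
  refine intervalIntegral.norm_integral_le_of_norm_le zero_le_one (ae_of_all _ fun s hs => ?_)
    ((by fun_prop : Continuous fun s : ℝ => s ^ N * K).intervalIntegrable _ _)
  rw [norm_mul, norm_pow, norm_real, Real.norm_of_nonneg hs.1.le]
  exact mul_le_mul_of_nonneg_left (hK _ (ofReal_mul_mem_ball hs.1.le hs.2 hz))
    (pow_nonneg hs.1.le _)

lemma ae_Ioc_imp_lt_one : ∀ᵐ s : ℝ, s ∈ Set.uIoc (0:ℝ) 1 → s ∈ Ioo (0:ℝ) 1 := by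
  filter_upwards [compl_mem_ae_iff.2 (measure_singleton (1:ℝ))] with s hs h
  rw [uIoc_of_le zero_le_one] at h
  exact ⟨h.1, lt_of_le_of_ne h.2 hs⟩

lemma continuousOn_moment {N : ℕ} {k : ℂ → ℂ} {K : ℝ} (hk : ContinuousOn k (ball 0 1))
    (hK : ∀ w ∈ ball (0:ℂ) 1, ‖k w‖ ≤ K) : ContinuousOn (moment N k) (closedBall 0 1) := by
  intro z hz
  refine intervalIntegral.continuousWithinAt_of_dominated_interval (bound := fun _ => K)
    ?_ ?_ intervalIntegrable_const ?_
  · filter_upwards [self_mem_nhdsWithin] with w hw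
    rw [uIoc_of_le zero_le_one, ← restrict_Ioo_eq_restrict_Ioc]
    refine ContinuousOn.aestronglyMeasurable ?_ measurableSet_Ioo
    refine (by fun_prop : Continuous fun s : ℝ => (s : ℂ) ^ N).continuousOn.mul ?_
    exact hk.comp (by fun_prop : Continuous fun s : ℝ => (s : ℂ) * w).continuousOn
      fun s hs => ofReal_mul_mem_ball_of_lt hs.1.le hs.2 hw
  · filter_upwards [self_mem_nhdsWithin] with w hw
    filter_upwards [ae_Ioc_imp_lt_one] with s hs hs'
    obtain ⟨h0, h1⟩ := hs hs'
    rw [norm_mul, norm_pow, norm_real, Real.norm_of_nonneg h0.le]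
    have h2 := hK _ (ofReal_mul_mem_ball_of_lt h0.le h1 hw)
    have h3 : s ^ N ≤ 1 := pow_le_one₀ h0.le h1.le
    nlinarith [norm_nonneg (k (s * w)), pow_nonneg h0.le N]
  · filter_upwards [ae_Ioc_imp_lt_one] with s hs hs'
    obtain ⟨h0, h1⟩ := hs hs'
    refine ContinuousWithinAt.mul continuousWithinAt_const ?_
    have := (hk.continuousAt
      (isOpen_ball.mem_nhds (ofReal_mul_mem_ball_of_lt h0.le h1 hz)))
    exact (ContinuousAt.comp (f := fun w : ℂ => (s : ℂ) * w) this
      (by fun_prop)).continuousWithinAt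

lemma differentiableOn_moment {N : ℕ} {k : ℂ → ℂ} (hk : DifferentiableOn ℂ k (ball 0 1)) :
    DifferentiableOn ℂ (moment N k) (ball 0 1) := by
  intro z hz
  have hz' : ‖z‖ < 1 := by simpa using hz
  obtain ⟨r, hzr, hr1⟩ := exists_between hz'
  have hsub : closedBall (0:ℂ) r ⊆ ball 0 1 := closedBall_subset_ball hr1
  have hdk : ContinuousOn (deriv k) (ball 0 1) := (hk.deriv isOpen_ball).continuousOn
  obtain ⟨D, hD⟩ := (isCompact_closedBall (0:ℂ) r).exists_bound_of_continuousOn (hdk.mono hsub)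
  have hmem : ball (0:ℂ) r ∈ 𝓝 z := isOpen_ball.mem_nhds (by simpa using hzr)
  have := (intervalIntegral.hasDerivAt_integral_of_dominated_loc_of_deriv_le
    (μ := volume) (a := 0) (b := 1)
    (F := fun (w : ℂ) (s : ℝ) => (s : ℂ) ^ N * k (s * w))
    (F' := fun (w : ℂ) (s : ℝ) => (s : ℂ) ^ N * (deriv k (s * w) * s))
    (bound := fun _ => D) hmem ?_ (intervalIntegrable_moment hk.continuousOn hz) ?_ ?_
    intervalIntegrable_const ?_).2
  · exact this.differentiableAt.differentiableWithinAt
  · filter_upwards [isOpen_ball.mem_nhds hz] with w hw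
    exact (intervalIntegrable_moment hk.continuousOn hw).aestronglyMeasurable_restrict_uIoc
  · have h := (intervalIntegrable_moment (N := N + 1) hdk hz).aestronglyMeasurable_restrict_uIoc
    refine h.congr (ae_of_all _ fun s => ?_)
    simp only
    ring
  · refine ae_of_all _ fun s hs w hw => ?_
    rw [uIoc_of_le zero_le_one] at hs
    have h1 := hD _ (ball_subset_closedBall (ofReal_mul_mem_ball hs.1.le hs.2 hw))
    have h3 : s ^ N ≤ 1 := pow_le_one₀ hs.1.le hs.2
    rw [norm_mul, norm_mul, norm_pow, norm_real, Real.norm_of_nonneg hs.1.le]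
    calc s ^ N * (‖deriv k (s * w)‖ * s) ≤ 1 * (D * 1) := by
          have := (norm_nonneg _).trans h1
          have := hs.1.le
          have := hs.2
          gcongr
      _ = D := by ring
  · refine ae_of_all _ fun s hs w hw => ?_
    rw [uIoc_of_le zero_le_one] at hs
    have hb : (s : ℂ) * w ∈ ball (0:ℂ) 1 :=
      hsub (ball_subset_closedBall (ofReal_mul_mem_ball hs.1.le hs.2 hw))
    have h1 := (hk.differentiableAt (isOpen_ball.mem_nhds hb)).hasDerivAt
    have h2 : HasDerivAt (fun w : ℂ => (s : ℂ) * w) s w := by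
      simpa using (hasDerivAt_id w).const_mul (s : ℂ)
    exact (h1.comp w h2).const_mul _

lemma memHinf_iff {f : ℂ → ℂ} : MemHinf f ↔
    DifferentiableOn ℂ f (ball 0 1) ∧ ∃ M, ∀ z ∈ ball (0:ℂ) 1, ‖f z‖ ≤ M := by
  refine and_congr_right fun _ => exists_congr fun M => ?_
  simp [mem_upperBounds]

lemma MemHinf.norm_le_supNorm {f : ℂ → ℂ} (hf : MemHinf f) {z : ℂ} (hz : z ∈ ball (0:ℂ) 1) :
    ‖f z‖ ≤ supNorm f :=
  le_csSup hf.2 ⟨z, hz, rfl⟩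

lemma supNorm_le {f : ℂ → ℂ} {M : ℝ} (h : ∀ z ∈ ball (0:ℂ) 1, ‖f z‖ ≤ M) : supNorm f ≤ M := by
  refine csSup_le ⟨_, 0, mem_ball_self one_pos, rfl⟩ ?_
  rintro _ ⟨z, hz, rfl⟩
  exact h z hz

lemma MemDiscAlg.memHinf {f : ℂ → ℂ} (hf : MemDiscAlg f) : MemHinf f := by
  obtain ⟨M, hM⟩ := (isCompact_closedBall (0:ℂ) 1).exists_bound_of_continuousOn hf.2
  exact memHinf_iff.2 ⟨hf.1, M, fun z hz => hM z (ball_subset_closedBall hz)⟩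

section

variable {t : ℝ} {N : ℕ} {f : ℂ → ℂ} {z lam : ℂ}

lemma one_sub_le_norm_one_sub_mul (ht0 : 0 ≤ t) (hz : z ∈ closedBall (0:ℂ) 1) :
    1 - t ≤ ‖1 - t * z‖ := by
  rw [mem_closedBall_zero_iff] at hz
  have h := norm_sub_norm_le (1:ℂ) (t * z)
  rw [norm_one, norm_mul, norm_real, Real.norm_of_nonneg ht0] at h
  nlinarith

lemma one_sub_mul_ne_zero (ht0 : 0 ≤ t) (ht1 : t < 1) (hz : z ∈ closedBall (0:ℂ) 1) :
    1 - t * z ≠ 0 := by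
  rw [← norm_pos_iff]
  linarith [one_sub_le_norm_one_sub_mul ht0 hz]

lemma differentiableOn_div_one_sub_mul (ht0 : 0 ≤ t) (ht1 : t < 1)
    (hf : DifferentiableOn ℂ f (ball 0 1)) :
    DifferentiableOn ℂ (fun w => f w / (1 - t * w)) (ball 0 1) :=
  hf.div (by fun_prop) fun _ hw => one_sub_mul_ne_zero ht0 ht1 (ball_subset_closedBall hw)

lemma norm_div_one_sub_mul_le (ht0 : 0 ≤ t) (ht1 : t < 1) {M : ℝ}
    (hM : ∀ w ∈ ball (0:ℂ) 1, ‖f w‖ ≤ M) (hz : z ∈ ball (0:ℂ) 1) :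
    ‖f z / (1 - t * z)‖ ≤ M / (1 - t) := by
  rw [norm_div]
  exact div_le_div₀ ((norm_nonneg _).trans (hM z hz)) (hM z hz) (by linarith)
    (one_sub_le_norm_one_sub_mul ht0 (ball_subset_closedBall hz))

lemma norm_shiftedCesaro_le (ht0 : 0 ≤ t) (ht1 : t < 1) {M : ℝ}
    (hM : ∀ w ∈ ball (0:ℂ) 1, ‖f w‖ ≤ M) (hz : z ∈ ball (0:ℂ) 1) :
    ‖shiftedCesaro t N f z‖ ≤ 1 / ((1 - t) * (N + 1)) * M := by
  refine (norm_moment_le (fun w hw => norm_div_one_sub_mul_le ht0 ht1 hM hw) hz).trans_eq ?_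
  rw [div_div, div_mul_eq_mul_div, one_mul]

lemma differentiableOn_shiftedCesaro (ht0 : 0 ≤ t) (ht1 : t < 1)
    (hf : DifferentiableOn ℂ f (ball 0 1)) :
    DifferentiableOn ℂ (shiftedCesaro t N f) (ball 0 1) :=
  differentiableOn_moment (differentiableOn_div_one_sub_mul ht0 ht1 hf)

lemma MemHinf.shiftedCesaro (ht0 : 0 ≤ t) (ht1 : t < 1) (hf : MemHinf f) :
    MemHinf (shiftedCesaro t N f) := by
  obtain ⟨hd, M, hM⟩ := memHinf_iff.1 hf
  exact memHinf_iff.2 ⟨differentiableOn_shiftedCesaro ht0 ht1 hd, _,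
    fun z hz => norm_shiftedCesaro_le ht0 ht1 hM hz⟩

lemma MemHinf.memDiscAlg_shiftedCesaro (ht0 : 0 ≤ t) (ht1 : t < 1) (hf : MemHinf f) :
    MemDiscAlg (_root_.shiftedCesaro t N f) := by
  obtain ⟨hd, M, hM⟩ := memHinf_iff.1 hf
  exact ⟨differentiableOn_shiftedCesaro ht0 ht1 hd,
    continuousOn_moment (differentiableOn_div_one_sub_mul ht0 ht1 hd).continuousOn
      fun w hw => norm_div_one_sub_mul_le ht0 ht1 hM hw⟩

lemma shiftedCesaro_apply_zero : shiftedCesaro t N f 0 = f 0 / (N + 1) := by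
  have h : ∫ s in (0:ℝ)..1, (s : ℂ) ^ N = 1 / (N + 1) := by
    have := integral_pow (a := 0) (b := 1) N
    have h2 : ∫ s in (0:ℝ)..1, (s : ℂ) ^ N = ((∫ s in (0:ℝ)..1, s ^ N : ℝ) : ℂ) := by
      rw [← intervalIntegral.integral_ofReal]
      simp
    rw [h2, this]
    simp
  simp [shiftedCesaro, moment, h]
  ring

lemma shiftedCesaro_congr {g : ℂ → ℂ} (h : EqOn f g (ball 0 1)) (hz : z ∈ ball (0:ℂ) 1) :
    shiftedCesaro t N f z = shiftedCesaro t N g z := by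
  refine intervalIntegral.integral_congr fun s hs => ?_
  rw [uIcc_of_le zero_le_one] at hs
  simp only [h (ofReal_mul_mem_ball hs.1 hs.2 hz)]

lemma shiftedCesaro_const_add_mul (ht0 : 0 ≤ t) (ht1 : t < 1) {a : ℂ}
    (hf : DifferentiableOn ℂ f (ball 0 1)) (hz : z ∈ ball (0:ℂ) 1) :
    shiftedCesaro t N (fun w => a + w * f w) z =
      a * shiftedCesaro t N (fun _ => 1) z + z * shiftedCesaro t (N + 1) f z := by
  have h1 := intervalIntegrable_moment (N := N) (differentiableOn_div_one_sub_mul ht0 ht1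
    (differentiableOn_const (1:ℂ))).continuousOn hz
  have h2 := intervalIntegrable_moment (N := N + 1)
    (differentiableOn_div_one_sub_mul ht0 ht1 hf).continuousOn hz
  simp only [shiftedCesaro, moment]
  rw [← intervalIntegral.integral_const_mul, ← intervalIntegral.integral_const_mul,
    ← intervalIntegral.integral_add (h1.const_mul a) (h2.const_mul z)]
  congr 1
  funext s
  ring

lemma norm_le_of_norm_mul_le {K : ℝ} (hf : DifferentiableOn ℂ f (ball 0 1))
    (hK : ∀ z ∈ ball (0:ℂ) 1, ‖z * f z‖ ≤ K) (hz : z ∈ ball (0:ℂ) 1) : ‖f z‖ ≤ K := by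
  have hd : DifferentiableOn ℂ (fun w => w * f w) (ball 0 1) := differentiableOn_id.mul hf
  have h := norm_dslope_le_div_of_mapsTo_ball (R₂ := K) hd
    (fun w hw => by simpa using hK w hw) hz
  have he : dslope (fun w => w * f w) 0 z = f z := by
    rcases eq_or_ne z 0 with rfl | h0
    · rw [dslope_same]
      have := (hasDerivAt_id (0:ℂ)).mul (hf.differentiableAt (isOpen_ball.mem_nhds hz)).hasDerivAt
      exact this.deriv.trans (by simp)
    · simp [dslope_of_ne _ h0, slope, h0]
  rwa [he, div_one] at h

lemma exists_eq_const_add_mul (hf : MemHinf f) :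
    ∃ g, MemHinf g ∧ ∀ z, f z = f 0 + z * g z := by
  obtain ⟨hd, M, hM⟩ := memHinf_iff.1 hf
  have hd' : DifferentiableOn ℂ (dslope f 0) (ball 0 1) :=
    (differentiableOn_dslope (ball_mem_nhds _ one_pos)).2 hd
  have he : ∀ z, f z = f 0 + z * dslope f 0 z := fun z => by
    have := sub_smul_dslope f 0 z
    rw [sub_zero, smul_eq_mul] at this
    rw [this]
    ring
  refine ⟨dslope f 0, memHinf_iff.2 ⟨hd', M + M, fun z hz => norm_le_of_norm_mul_le hd'
    (fun w hw => ?_) hz⟩, he⟩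
  rw [← sub_eq_iff_eq_add'.2 (he w)]
  exact (norm_sub_le _ _).trans (add_le_add (hM w hw) (hM 0 (mem_ball_self one_pos)))

lemma MemHinf.const (a : ℂ) : MemHinf fun _ => a :=
  memHinf_iff.2 ⟨differentiableOn_const a, ‖a‖, fun _ _ => le_rfl⟩

lemma MemHinf.add {g : ℂ → ℂ} (hf : MemHinf f) (hg : MemHinf g) : MemHinf fun z => f z + g z := by
  obtain ⟨hd, M, hM⟩ := memHinf_iff.1 hf
  obtain ⟨hd', M', hM'⟩ := memHinf_iff.1 hg
  exact memHinf_iff.2 ⟨hd.add hd', M + M', fun z hz =>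
    (norm_add_le _ _).trans (add_le_add (hM z hz) (hM' z hz))⟩

lemma MemHinf.mul {g : ℂ → ℂ} (hf : MemHinf f) (hg : MemHinf g) : MemHinf fun z => f z * g z := by
  obtain ⟨hd, M, hM⟩ := memHinf_iff.1 hf
  obtain ⟨hd', M', hM'⟩ := memHinf_iff.1 hg
  refine memHinf_iff.2 ⟨hd.mul hd', M * M', fun z hz => ?_⟩
  rw [norm_mul]
  exact mul_le_mul (hM z hz) (hM' z hz) (norm_nonneg _) ((norm_nonneg _).trans (hM z hz))

lemma MemHinf.sub {g : ℂ → ℂ} (hf : MemHinf f) (hg : MemHinf g) : MemHinf fun z => f z - g z := by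
  simpa [sub_eq_add_neg] using hf.add ((MemHinf.const (-1)).mul hg)

lemma memHinf_id : MemHinf fun w => w :=
  memHinf_iff.2 ⟨differentiableOn_id, 1, fun _ hz => (mem_ball_zero_iff.1 hz).le⟩

end

/-- `λ - z^{-N} C_t z^N` maps `H^∞` onto `H^∞` and is bounded below. -/
def ShiftedResolvent (t : ℝ) (N : ℕ) (lam : ℂ) : Prop :=
  (∀ g, MemHinf g → ∃ f, MemHinf f ∧
    ∀ z ∈ ball (0:ℂ) 1, lam * f z - shiftedCesaro t N f z = g z) ∧
  ∃ C : ℝ, 0 ≤ C ∧ ∀ f, MemHinf f → ∀ M,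
    (∀ z ∈ ball (0:ℂ) 1, ‖lam * f z - shiftedCesaro t N f z‖ ≤ M) →
      ∀ z ∈ ball (0:ℂ) 1, ‖f z‖ ≤ C * M

section

variable {t : ℝ} {N : ℕ} {lam : ℂ}

lemma ShiftedResolvent.of_succ (ht0 : 0 ≤ t) (ht1 : t < 1) (hlam : lam ≠ 1 / ((N : ℂ) + 1))
    (h : ShiftedResolvent t (N + 1) lam) : ShiftedResolvent t N lam := by
  obtain ⟨hsurj, C, hC0, hC⟩ := h
  have hd : lam - 1 / ((N : ℂ) + 1) ≠ 0 := sub_ne_zero.2 hlam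
  have h0 : (0:ℂ) ∈ ball (0:ℂ) 1 := mem_ball_self one_pos
  have hone : MemHinf (shiftedCesaro t N fun _ => 1) := (MemHinf.const 1).shiftedCesaro ht0 ht1
  refine ⟨fun g hg => ?_, ?_⟩
  · obtain ⟨a, ha⟩ : ∃ a, a * (lam - 1 / ((N : ℂ) + 1)) = g 0 := ⟨_, div_mul_cancel₀ _ hd⟩
    obtain ⟨q, hq, hgq⟩ := exists_eq_const_add_mul
      ((hg.sub (MemHinf.const (lam * a))).add ((MemHinf.const a).mul hone))
    obtain ⟨f, hf, hfq⟩ := hsurj q hq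
    refine ⟨fun z => a + z * f z, (MemHinf.const a).add (memHinf_id.mul hf), fun z hz => ?_⟩
    rw [shiftedCesaro_const_add_mul ht0 ht1 hf.1 hz]
    have h1 := hgq z
    rw [shiftedCesaro_apply_zero, ← hfq z hz, ← ha] at h1
    linear_combination -h1
  · set d := ‖lam - 1 / ((N : ℂ) + 1)‖ with hdd
    have hdpos : 0 < d := norm_pos_iff.2 hd
    obtain ⟨-, B, hB⟩ := memHinf_iff.1 hone
    have hB0 : 0 ≤ B := (norm_nonneg _).trans (hB 0 h0)
    refine ⟨1 / d + C * (1 + (‖lam‖ + B) / d), by positivity, fun f hf M hM z hz => ?_⟩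
    have hM0 : 0 ≤ M := (norm_nonneg _).trans (hM 0 h0)
    obtain ⟨q, hq, hfq⟩ := exists_eq_const_add_mul hf
    have ha : ‖f 0‖ ≤ M / d := by
      rw [le_div_iff₀ hdpos, hdd, ← norm_mul]
      refine (congrArg _ ?_).trans_le (hM 0 h0)
      rw [shiftedCesaro_apply_zero]
      ring
    have hrq : ∀ w ∈ ball (0:ℂ) 1, ‖w * (lam * q w - shiftedCesaro t (N + 1) q w)‖ ≤
        M + (‖lam‖ + B) * (M / d) := fun w hw => by
      have e : w * (lam * q w - shiftedCesaro t (N + 1) q w) =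
          (lam * f w - shiftedCesaro t N f w) - lam * f 0 +
            shiftedCesaro t N (fun _ => 1) w * f 0 := by
        have e1 := shiftedCesaro_const_add_mul (N := N) (a := f 0) ht0 ht1 hq.1 hw
        rw [← funext hfq] at e1
        rw [e1, hfq w]
        ring
      rw [e]
      refine (norm_add_le _ _).trans ?_
      have h1 := norm_sub_le (lam * f w - shiftedCesaro t N f w) (lam * f 0)
      have h2 := hM w hw
      have h3 : ‖lam * f 0‖ ≤ ‖lam‖ * (M / d) := by rw [norm_mul]; gcongr
      have h4 : ‖shiftedCesaro t N (fun _ => 1) w * f 0‖ ≤ B * (M / d) := by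
        rw [norm_mul]
        exact mul_le_mul (hB w hw) ha (norm_nonneg _) hB0
      linarith
    have hqz := hC q hq _ (fun w hw => norm_le_of_norm_mul_le
      (f := fun w => lam * q w - shiftedCesaro t (N + 1) q w)
      (((MemHinf.const lam).mul hq).sub (hq.shiftedCesaro ht0 ht1)).1 hrq hw) z hz
    have hzq : ‖z * q z‖ ≤ ‖q z‖ := by
      rw [norm_mul]
      exact mul_le_of_le_one_left (norm_nonneg _) (mem_ball_zero_iff.1 hz).le
    calc ‖f z‖ ≤ ‖f 0‖ + ‖z * q z‖ := by 
          conv_lhs => rw [hfq z]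
          exact norm_add_le _ _
      _ ≤ M / d + C * (M + (‖lam‖ + B) * (M / d)) := by linarith
      _ = _ := by ring

end

section

variable {t : ℝ} {N : ℕ} {lam : ℂ}

lemma norm_iterate_shiftedCesaro_le (ht0 : 0 ≤ t) (ht1 : t < 1) {g : ℂ → ℂ} {M : ℝ}
    (hM : ∀ z ∈ ball (0:ℂ) 1, ‖g z‖ ≤ M) (n : ℕ) :
    ∀ z ∈ ball (0:ℂ) 1, ‖(shiftedCesaro t N)^[n] g z‖ ≤ (1 / ((1 - t) * (N + 1))) ^ n * M := by
  induction n with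
  | zero => simpa using hM
  | succ n ih =>
    intro z hz
    rw [Function.iterate_succ_apply']
    exact (norm_shiftedCesaro_le ht0 ht1 ih hz).trans_eq (by ring)

lemma MemHinf.iterate_shiftedCesaro (ht0 : 0 ≤ t) (ht1 : t < 1) {g : ℂ → ℂ} (hg : MemHinf g)
    (n : ℕ) : MemHinf ((_root_.shiftedCesaro t N)^[n] g) := by
  induction n with
  | zero => exact hg
  | succ n ih =>
    rw [Function.iterate_succ_apply']
    exact ih.shiftedCesaro ht0 ht1

lemma shiftedCesaro_tsum (ht0 : 0 ≤ t) (ht1 : t < 1) {u : ℕ → ℂ → ℂ} {b : ℕ → ℝ}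
    (hb : Summable b) (hu : ∀ n, MemHinf (u n)) (hub : ∀ n, ∀ z ∈ ball (0:ℂ) 1, ‖u n z‖ ≤ b n)
    {z : ℂ} (hz : z ∈ ball (0:ℂ) 1) :
    HasSum (fun n => shiftedCesaro t N (u n) z) (shiftedCesaro t N (fun w => ∑' n, u n w) z) := by
  refine intervalIntegral.hasSum_integral_of_dominated_convergence
    (fun n _ => b n / (1 - t)) (fun n => ?_) (fun n => ?_) ?_ intervalIntegrable_const ?_
  · exact (intervalIntegrable_moment (differentiableOn_div_one_sub_mul ht0 ht1
      (hu n).1).continuousOn hz).aestronglyMeasurable_restrict_uIoc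
  · refine ae_of_all _ fun s hs => ?_
    rw [uIoc_of_le zero_le_one] at hs
    rw [norm_mul, norm_pow, norm_real, Real.norm_of_nonneg hs.1.le]
    have h1 := norm_div_one_sub_mul_le ht0 ht1 (hub n) (ofReal_mul_mem_ball hs.1.le hs.2 hz)
    exact (mul_le_of_le_one_left (norm_nonneg _) (pow_le_one₀ hs.1.le hs.2)).trans h1
  · exact ae_of_all _ fun _ _ => hb.div_const _
  · refine ae_of_all _ fun s hs => ?_
    rw [uIoc_of_le zero_le_one] at hs
    have hsz := ofReal_mul_mem_ball hs.1.le hs.2 hz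
    exact ((Summable.of_norm_bounded hb fun n => hub n _ hsz).hasSum.div_const _).mul_left _

lemma exists_sub_shiftedCesaro_eq (ht0 : 0 ≤ t) (ht1 : t < 1)
    (hN : 1 / ((1 - t) * (N + 1)) < ‖lam‖) {g : ℂ → ℂ} (hg : MemHinf g) :
    ∃ f, MemHinf f ∧ ∀ z ∈ ball (0:ℂ) 1, lam * f z - shiftedCesaro t N f z = g z := by
  obtain ⟨-, M, hM⟩ := memHinf_iff.1 hg
  set c := 1 / ((1 - t) * (N + 1)) with hc
  have hc0 : 0 ≤ c := by
    have := sub_pos.2 ht1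
    positivity
  have hlam : 0 < ‖lam‖ := hc0.trans_lt hN
  have hlam0 : lam ≠ 0 := norm_pos_iff.1 hlam
  let u : ℕ → ℂ → ℂ := fun n z => (lam⁻¹) ^ (n + 1) * (shiftedCesaro t N)^[n] g z
  let b : ℕ → ℝ := fun n => (c / ‖lam‖) ^ n * (M / ‖lam‖)
  have hb : Summable b :=
    (summable_geometric_of_lt_one (by positivity) ((div_lt_one hlam).2 hN)).mul_right _
  have hu : ∀ n, MemHinf (u n) := fun n =>
    (MemHinf.const _).mul (hg.iterate_shiftedCesaro ht0 ht1 n)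
  have hub : ∀ n, ∀ z ∈ ball (0:ℂ) 1, ‖u n z‖ ≤ b n := fun n z hz => by
    have h : _ ≤ c ^ n * M := norm_iterate_shiftedCesaro_le (N := N) ht0 ht1 hM n z hz
    clear_value c
    simp only [u, b, norm_mul, norm_pow, norm_inv]
    calc _ ≤ ‖lam‖⁻¹ ^ (n + 1) * (c ^ n * M) := by gcongr
      _ = _ := by rw [div_pow, inv_pow]; field_simp; ring
  refine ⟨fun z => ∑' n, u n z, memHinf_iff.2
    ⟨differentiableOn_tsum_of_summable_norm hb (fun n => (hu n).1) isOpen_ball hub, ∑' n, b n,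
      fun z hz => tsum_of_norm_bounded hb.hasSum fun n => hub n z hz⟩, fun z hz => ?_⟩
  have hsum : Summable fun n => u n z := Summable.of_norm_bounded hb fun n => hub n z hz
  have hT := shiftedCesaro_tsum (N := N) ht0 ht1 hb hu hub hz
  have hstep : ∀ n, shiftedCesaro t N (u n) z = lam * u (n + 1) z := fun n => by
    simp only [u, Function.iterate_succ_apply']
    rw [pow_succ _ (n + 1), ← mul_assoc, mul_comm lam, mul_assoc _ lam⁻¹ lam,
      inv_mul_cancel₀ hlam0, mul_one]
    simp only [shiftedCesaro, moment]
    rw [← intervalIntegral.integral_const_mul]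
    congr 1
    funext s
    ring
  simp only [hstep] at hT
  have h2 : HasSum (fun n => lam * u (n + 1) z) (lam * (∑' n, u n z - u 0 z)) := by
    refine HasSum.mul_left _ ?_
    simpa using (hasSum_nat_add_iff' 1).2 hsum.hasSum
  rw [hT.unique h2]
  simp only [u, Function.iterate_zero, id, zero_add, pow_one]
  field_simp
  ring

lemma ShiftedResolvent.of_norm_lt (ht0 : 0 ≤ t) (ht1 : t < 1)
    (hN : 1 / ((1 - t) * (N + 1)) < ‖lam‖) : ShiftedResolvent t N lam := by
  refine ⟨fun g hg => exists_sub_shiftedCesaro_eq ht0 ht1 hN hg, ?_⟩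
  set c := 1 / ((1 - t) * (N + 1)) with hc
  have hd : 0 < ‖lam‖ - c := sub_pos.2 hN
  refine ⟨1 / (‖lam‖ - c), by positivity, fun f hf M hM z hz => ?_⟩
  have hc0 : 0 ≤ c := by
    have := sub_pos.2 ht1
    positivity
  have hlam : 0 < ‖lam‖ := hc0.trans_lt hN
  have h : supNorm f ≤ (M + c * supNorm f) / ‖lam‖ := supNorm_le fun w hw => by
    rw [le_div_iff₀ hlam, mul_comm, ← norm_mul]
    have h1 := norm_shiftedCesaro_le (N := N) ht0 ht1 (fun w hw => hf.norm_le_supNorm hw) hw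
    have h2 := norm_sub_norm_le (lam * f w) (shiftedCesaro t N f w)
    linarith [hM w hw]
  rw [le_div_iff₀ hlam] at h
  refine (hf.norm_le_supNorm hz).trans ?_
  rw [one_div_mul_eq_div, le_div_iff₀ hd]
  linarith

lemma shiftedResolvent_zero (ht0 : 0 ≤ t) (ht1 : t < 1) (h0 : lam ≠ 0)
    (hlam : ∀ m : ℕ, lam ≠ 1 / ((m : ℂ) + 1)) : ShiftedResolvent t 0 lam := by
  obtain ⟨n, hn⟩ := exists_nat_one_div_lt (mul_pos (sub_pos.2 ht1) (norm_pos_iff.2 h0))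
  have hn' : ShiftedResolvent t n lam := by
    refine .of_norm_lt ht0 ht1 ?_
    have := sub_pos.2 ht1
    rw [mul_comm, ← div_div, div_lt_iff₀ this, mul_comm ‖lam‖]
    exact hn
  exact Nat.decreasingInduction (motive := fun k _ => ShiftedResolvent t k lam)
    (fun k _ hk => hk.of_succ ht0 ht1 (hlam k)) hn' (Nat.zero_le n)

lemma MemHinf.resolvent_apply (ht0 : 0 ≤ t) (ht1 : t < 1) {f : ℂ → ℂ} (hf : MemHinf f) :
    MemHinf fun z => lam * f z - cesaro t f z := by
  rw [cesaro_eq_shiftedCesaro_zero]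
  exact ((MemHinf.const lam).mul hf).sub (hf.shiftedCesaro ht0 ht1)

lemma MemDiscAlg.resolvent_apply (ht0 : 0 ≤ t) (ht1 : t < 1) {f : ℂ → ℂ} (hf : MemDiscAlg f) :
    MemDiscAlg fun z => lam * f z - cesaro t f z := by
  refine ⟨(hf.memHinf.resolvent_apply ht0 ht1).1, ?_⟩
  rw [cesaro_eq_shiftedCesaro_zero]
  exact (continuousOn_const.mul hf.2).sub (hf.memHinf.memDiscAlg_shiftedCesaro ht0 ht1).2

lemma ShiftedResolvent.exists_supNorm_le (ht0 : 0 ≤ t) (ht1 : t < 1)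
    (h : ShiftedResolvent t 0 lam) : ∃ C : ℝ, ∀ f, MemHinf f →
      supNorm f ≤ C * supNorm fun z => lam * f z - cesaro t f z := by
  obtain ⟨-, C, -, hC⟩ := h
  rw [← funext (cesaro_eq_shiftedCesaro_zero t)] at hC
  exact ⟨C, fun f hf => supNorm_le (hC f hf _ fun z hz =>
    (hf.resolvent_apply ht0 ht1).norm_le_supNorm hz)⟩

lemma ShiftedResolvent.isResolventPt_memHinf (ht0 : 0 ≤ t) (ht1 : t < 1)
    (h : ShiftedResolvent t 0 lam) : IsResolventPt MemHinf supNorm (cesaro t) lam := by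
  refine ⟨fun f hf => hf.resolvent_apply ht0 ht1, ?_, h.exists_supNorm_le ht0 ht1⟩
  rw [funext (cesaro_eq_shiftedCesaro_zero t)]
  exact h.1

lemma ShiftedResolvent.isResolventPt_memDiscAlg (ht0 : 0 ≤ t) (ht1 : t < 1) (h0 : lam ≠ 0)
    (h : ShiftedResolvent t 0 lam) : IsResolventPt MemDiscAlg supNorm (cesaro t) lam := by
  obtain ⟨C, hC⟩ := h.exists_supNorm_le ht0 ht1
  refine ⟨fun f hf => hf.resolvent_apply ht0 ht1, fun g hg => ?_, C, fun f hf => hC f hf.memHinf⟩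
  obtain ⟨f, hf, hfg⟩ := h.1 g hg.memHinf
  have hT := hf.memDiscAlg_shiftedCesaro (N := 0) ht0 ht1
  refine ⟨fun z => lam⁻¹ * (g z + shiftedCesaro t 0 f z), ⟨(hg.1.add hT.1).const_mul _,
    continuousOn_const.mul (hg.2.add hT.2)⟩, fun z hz => ?_⟩
  have he : EqOn (fun z => lam⁻¹ * (g z + shiftedCesaro t 0 f z)) f (ball 0 1) := fun w hw => by
    simp only [← hfg w hw]
    field_simp
    ring
  simp only [cesaro_eq_shiftedCesaro_zero]
  rw [shiftedCesaro_congr he hz, mul_inv_cancel_left₀ h0]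
  ring

lemma cesaro_pow (n : ℕ) (z : ℂ) :
    cesaro t (fun w => w ^ n) z = z ^ n * shiftedCesaro t n (fun _ => 1) z := by
  simp only [cesaro, shiftedCesaro, moment]
  rw [← intervalIntegral.integral_const_mul]
  congr 1
  funext s
  ring

lemma cesaro_eigenvector (ht0 : 0 ≤ t) (ht1 : t < 1) (m : ℕ) {z : ℂ} (hz : z ∈ ball (0:ℂ) 1) :
    cesaro t (fun w => w ^ m / (1 - t * w) ^ (m + 1)) z =
      1 / ((m : ℂ) + 1) * (z ^ m / (1 - t * z) ^ (m + 1)) := by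
  have hm : (m : ℂ) + 1 ≠ 0 := Nat.cast_add_one_ne_zero m
  have hden : ∀ s ∈ uIcc (0:ℝ) 1, 1 - t * ((s : ℂ) * z) ≠ 0 := fun s hs => by
    rw [uIcc_of_le zero_le_one] at hs
    exact one_sub_mul_ne_zero ht0 ht1
      (ball_subset_closedBall (ofReal_mul_mem_ball hs.1 hs.2 hz))
  have hderiv : ∀ s ∈ uIcc (0:ℝ) 1, HasDerivAt
      (fun s : ℝ => z ^ m / (m + 1) * ((s : ℂ) / (1 - t * ((s : ℂ) * z))) ^ (m + 1))
      (((s : ℂ) * z) ^ m / (1 - t * ((s : ℂ) * z)) ^ (m + 1) / (1 - s * t * z)) s := by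
    intro s hs
    have hs0 := hden s hs
    have h1 : HasDerivAt (fun s : ℝ => (s : ℂ)) 1 s := by
      simpa using (hasDerivAt_id s).ofReal_comp
    have h2 : HasDerivAt (fun s : ℝ => 1 - t * ((s : ℂ) * z)) (-(t * (1 * z))) s :=
      ((h1.mul_const z).const_mul (t : ℂ)).const_sub 1
    refine (((h1.fun_div h2 hs0).fun_pow (m + 1)).const_mul
      (z ^ m / ((m : ℂ) + 1))).congr_deriv ?_
    rw [show 1 - s * t * z = 1 - t * ((s : ℂ) * z) by ring]
    simp only [Nat.add_sub_cancel, div_pow, mul_pow]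
    push_cast
    field_simp
    ring
  have hint : IntervalIntegrable (fun s : ℝ =>
      ((s : ℂ) * z) ^ m / (1 - t * ((s : ℂ) * z)) ^ (m + 1) / (1 - s * t * z)) volume 0 1 := by
    refine ContinuousOn.intervalIntegrable (ContinuousOn.div (ContinuousOn.div ?_ ?_ ?_) ?_ ?_)
    · fun_prop
    · fun_prop
    · exact fun s hs => pow_ne_zero _ (hden s hs)
    · fun_prop
    · intro s hs
      rw [mul_comm (s : ℂ), mul_assoc]
      exact hden s hs
  rw [cesaro, intervalIntegral.integral_eq_sub_of_hasDerivAt hderiv hint]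
  simp only [ofReal_one, one_mul, ofReal_zero, zero_div, div_pow, one_pow,
    zero_pow (Nat.succ_ne_zero m), mul_zero, sub_zero]
  ring

lemma not_isResolventPt_of_memDiscAlg_subset {Mem : (ℂ → ℂ) → Prop}
    (hMem : ∀ f, MemDiscAlg f → Mem f) (ht0 : 0 ≤ t) (ht1 : t < 1)
    (hlam : lam = 0 ∨ ∃ m : ℕ, lam = 1 / ((m : ℂ) + 1)) :
    ¬ IsResolventPt Mem supNorm (cesaro t) lam := by
  rintro ⟨-, -, C, hC⟩
  rcases hlam with rfl | ⟨m, rfl⟩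
  · have hp : ∀ n : ℕ, MemDiscAlg fun z => z ^ n := fun n =>
      ⟨by fun_prop, by fun_prop⟩
    have hlow : ∀ n : ℕ, 1 ≤ supNorm fun z => z ^ n := fun n => by
      have hlim : Tendsto (fun r : ℝ => r ^ n) (𝓝[<] 1) (𝓝 1) := by
        have : ContinuousAt (fun r : ℝ => r ^ n) 1 := by fun_prop
        simpa using this.tendsto.mono_left nhdsWithin_le_nhds
      refine le_of_tendsto hlim ?_
      filter_upwards [Ioo_mem_nhdsLT zero_lt_one] with r hr
      have hr' : (r : ℂ) ∈ ball (0:ℂ) 1 := by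
        rw [mem_ball_zero_iff, norm_real, Real.norm_of_nonneg hr.1.le]
        exact hr.2
      simpa [abs_of_pos hr.1] using (hp n).memHinf.norm_le_supNorm hr'
    have hup : ∀ n : ℕ, supNorm (fun z => 0 * z ^ n - cesaro t (fun z => z ^ n) z) ≤
        1 / ((1 - t) * (n + 1)) := fun n => by
      refine supNorm_le fun z hz => ?_
      rw [zero_mul, zero_sub, norm_neg, cesaro_pow, norm_mul, norm_pow]
      have h1 := norm_shiftedCesaro_le (f := fun _ => 1) (N := n) ht0 ht1
        (fun _ _ => norm_one.le) hz
      rw [mul_one] at h1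
      exact (mul_le_of_le_one_left (norm_nonneg _)
        (pow_le_one₀ (norm_nonneg z) (mem_ball_zero_iff.1 hz).le)).trans h1
    have ht := sub_pos.2 ht1
    obtain ⟨n, hn⟩ := exists_nat_gt (|C| / (1 - t))
    have h1 := (hlow n).trans (hC _ (hMem _ (hp n)))
    have h2 : |C| * (1 / ((1 - t) * (n + 1))) < 1 := by
      rw [div_lt_iff₀ ht] at hn
      rw [mul_one_div, div_lt_one (by positivity)]
      linarith
    have h3 : 0 ≤ supNorm (fun z => 0 * z ^ n - cesaro t (fun z => z ^ n) z) :=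
      (norm_nonneg _).trans
        (((hp n).memHinf.resolvent_apply ht0 ht1).norm_le_supNorm (mem_ball_self one_pos))
    have h4 := mul_le_mul_of_nonneg_right (le_abs_self C) h3
    have h5 := mul_le_mul_of_nonneg_left (hup n) (abs_nonneg C)
    linarith
  · let f : ℂ → ℂ := fun z => z ^ m / (1 - t * z) ^ (m + 1)
    have hden : ∀ z ∈ closedBall (0:ℂ) 1, 1 - t * z ≠ 0 := fun z hz =>
      one_sub_mul_ne_zero ht0 ht1 hz
    have hf : MemDiscAlg f := by
      refine ⟨DifferentiableOn.div (by fun_prop) (by fun_prop) fun z hz => ?_,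
        ContinuousOn.div (by fun_prop) (by fun_prop) fun z hz => ?_⟩
      · exact pow_ne_zero _ (hden z (ball_subset_closedBall hz))
      · exact pow_ne_zero _ (hden z hz)
    have heig : ∀ z ∈ ball (0:ℂ) 1, 1 / ((m : ℂ) + 1) * f z - cesaro t f z = 0 := fun z hz => by
      rw [cesaro_eigenvector ht0 ht1 m hz, sub_self]
    have h1 := hC f (hMem f hf)
    have h2 : supNorm (fun z => 1 / ((m : ℂ) + 1) * f z - cesaro t f z) = 0 :=
      le_antisymm (supNorm_le fun z hz => by rw [heig z hz, norm_zero])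
        ((norm_nonneg _).trans
          ((hf.memHinf.resolvent_apply ht0 ht1).norm_le_supNorm (mem_ball_self one_pos)))
    rw [h2, mul_zero] at h1
    have hhalf : (2⁻¹ : ℂ) ∈ ball (0:ℂ) 1 := by
      rw [mem_ball_zero_iff]
      norm_num
    have h3 := norm_le_zero_iff.1 ((hf.memHinf.norm_le_supNorm hhalf).trans h1)
    exact div_ne_zero (pow_ne_zero _ (by norm_num))
      (pow_ne_zero _ (hden _ (ball_subset_closedBall hhalf))) h3

end

/-- For each `t ∈ [0,1)`, the spectrum of `C_t` on `H^∞` and on `A(𝔻)` equals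
`{1/(m+1) : m ∈ ℕ₀} ∪ {0}`. -/
theorem cesaro_spectrum_Hinf_discAlg (t : ℝ) (ht0 : 0 ≤ t) (ht1 : t < 1) (lam : ℂ) :
    ((¬ IsResolventPt MemHinf supNorm (cesaro t) lam) ↔
      (lam = 0 ∨ ∃ m : ℕ, lam = 1 / ((m : ℂ) + 1))) ∧
    ((¬ IsResolventPt MemDiscAlg supNorm (cesaro t) lam) ↔
      (lam = 0 ∨ ∃ m : ℕ, lam = 1 / ((m : ℂ) + 1))) := by
  refine ⟨⟨fun h => ?_,
    not_isResolventPt_of_memDiscAlg_subset (fun _ => MemDiscAlg.memHinf) ht0 ht1⟩,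
    ⟨fun h => ?_, not_isResolventPt_of_memDiscAlg_subset (fun _ => id) ht0 ht1⟩⟩
  · contrapose! h
    exact (shiftedResolvent_zero ht0 ht1 h.1 h.2).isResolventPt_memHinf ht0 ht1
  · contrapose! h
    exact (shiftedResolvent_zero ht0 ht1 h.1 h.2).isResolventPt_memDiscAlg ht0 ht1 h.1
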